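/- arXiv:0804.3672 — 2 statements merged into one kernel-verified Lean document; each statement's English description precedes it below -/
import Mathlib

section
/- Let α ∈ (1/2, 1), ζ > 0, θ > 0, let N ≥ 1 and let h₁, …, h_N be i.i.d. random variables uniform on {−1, +1}. Let Δ₀ < Δ₁ < … < Δ_K be strictly increasing positive integers, let n₀, …, n_K be positive integers, set M_i = Σ_{ℓ=0}^{i} n_ℓ Δ_ℓ and assume M_K ≤ N. Fix j ∈ {−1, 0, …, K−1} and let F_{j+1}, …, F_K : {−1,+1}^N → ℝ be functions such that: (i) for every i and every pair of configurations x, y differing in exactly one coordinate, |F_i(x) − F_i(y)| ≤ 4θ; and (ii) for every i ∈ {j+1, …, K} and every 0 ≤ r ≤ N − M_i, E[F_i(h₁,…,h_N) | σ(h₁,…,h_r)] = 0 almost surely. Then P[ for all i ∈ {j+1,…,K}: F_i(h₁,…,h_N) > (ζ/4) Σ_{ℓ=0}^{i} n_ℓ Δ_ℓ^α ] ≤ exp( − (ζ²/(2¹⁰ θ²)) Σ_{ℓ=j+1}^{K} n_ℓ Δ_ℓ^{2α−1} ). -/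
open scoped BigOperators Classical

noncomputable section

/-- The two-point set `{-1, +1} ⊂ ℝ` of values of the symmetric Bernoulli field. -/
def pmOne : Finset ℝ := {-1, 1}

def negPm (a : pmOne) : pmOne := ⟨-a.1, by
  have := a.2
  simp only [pmOne, Finset.mem_insert, Finset.mem_singleton] at this ⊢
  rcases this with h | h <;> simp [h]⟩

lemma negPm_negPm (a : pmOne) : negPm (negPm a) = a := by
  apply Subtype.ext; simp [negPm]

lemma negPm_ne (a : pmOne) : negPm a ≠ a := by
  intro h
  have h1 := congrArg Subtype.val h
  have := a.2
  simp only [pmOne, Finset.mem_insert, Finset.mem_singleton] at this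
  simp only [negPm] at h1
  rcases this with h | h <;> rw [h] at h1 <;> norm_num at h1

lemma eq_or_eq_negPm (a b : pmOne) : b = a ∨ b = negPm a := by
  have ha := a.2
  have hb := b.2
  simp only [pmOne, Finset.mem_insert, Finset.mem_singleton] at ha hb
  rcases ha with h | h <;> rcases hb with h' | h'
  · left; apply Subtype.ext; rw [h, h']
  · right; apply Subtype.ext; simp [negPm, h, h']
  · right; apply Subtype.ext; simp [negPm, h, h']
  · left; apply Subtype.ext; rw [h, h']

def flipAt {N : ℕ} (k : Fin N) (x : Fin N → pmOne) : Fin N → pmOne :=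
  Function.update x k (negPm (x k))

lemma flipAt_same {N : ℕ} (k : Fin N) (x : Fin N → pmOne) : flipAt k x k = negPm (x k) := by
  simp [flipAt]

lemma flipAt_ne {N : ℕ} (k : Fin N) (x : Fin N → pmOne) (j : Fin N) (h : j ≠ k) :
    flipAt k x j = x j := by
  simp [flipAt, h]

lemma flipAt_invol {N : ℕ} (k : Fin N) : Function.Involutive (flipAt (N := N) k) := by
  intro x
  funext j
  by_cases h : j = k
  · subst h; rw [flipAt_same, flipAt_same, negPm_negPm]
  · rw [flipAt_ne _ _ _ h, flipAt_ne _ _ _ h]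

lemma sum_flipAt {N : ℕ} (k : Fin N) (f : (Fin N → pmOne) → ℝ) :
    ∑ x, f (flipAt k x) = ∑ x, f x :=
  Equiv.sum_comp (flipAt_invol k).toPerm f

/-- agreement on the first `r` coordinates -/
def Agr {N : ℕ} (r : ℕ) (y x : Fin N → pmOne) : Prop := ∀ k : Fin N, (k : ℕ) < r → y k = x k

/-- average over the configurations agreeing on the first `r` coordinates -/
def Av {N : ℕ} (f : (Fin N → pmOne) → ℝ) (r : ℕ) (x : Fin N → pmOne) : ℝ :=
  (2 ^ r / 2 ^ N) * ∑ y, if Agr r y x then f y else 0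

lemma Av_top {N : ℕ} (f : (Fin N → pmOne) → ℝ) (x : Fin N → pmOne) : Av f N x = f x := by
  have : ∀ y, Agr N y x ↔ y = x := by
    intro y
    constructor
    · intro h; funext k; exact h k k.2
    · rintro rfl k _; rfl
  simp [Av, this]

lemma agr_succ {N : ℕ} (r : Fin N) (y x : Fin N → pmOne) :
    Agr ((r : ℕ) + 1) y x ↔ Agr r y x ∧ y r = x r := by
  constructor
  · intro h
    exact ⟨fun k hk => h k (by omega), h r (by omega)⟩
  · rintro ⟨h, h2⟩ k hk
    by_cases hkr : k = r
    · subst hkr; exact h2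
    · exact h k (by have : (k : ℕ) ≠ r := fun h => hkr (Fin.ext h); omega)

lemma agr_flip {N : ℕ} (r : Fin N) (y x : Fin N → pmOne) :
    Agr (r : ℕ) y (flipAt r x) ↔ Agr r y x := by
  unfold Agr
  refine forall_congr' fun k => forall_congr' fun hk => ?_
  rw [flipAt_ne]
  rintro rfl; omega

lemma agr_flip_left {N : ℕ} (r : Fin N) (y x : Fin N → pmOne) :
    Agr (r : ℕ) (flipAt r y) x ↔ Agr r y x := by
  unfold Agr
  refine forall_congr' fun k => forall_congr' fun hk => ?_
  rw [flipAt_ne]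
  rintro rfl; omega

lemma Av_flip {N : ℕ} (f : (Fin N → pmOne) → ℝ) (r : Fin N) (x : Fin N → pmOne) :
    Av f r (flipAt r x) = Av f r x := by
  simp only [Av, agr_flip]

lemma Av_split {N : ℕ} (f : (Fin N → pmOne) → ℝ) (r : Fin N) (x : Fin N → pmOne) :
    2 * Av f r x = Av f ((r : ℕ) + 1) x + Av f ((r : ℕ) + 1) (flipAt r x) := by
  simp only [Av]
  rw [← mul_add, ← Finset.sum_add_distrib, ← mul_assoc, pow_succ]
  have : ∀ y, (if Agr r y x then f y else 0) = (if Agr ((r:ℕ)+1) y x then f y else 0) +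
      (if Agr ((r:ℕ)+1) y (flipAt r x) then f y else 0) := by
    intro y
    simp only [agr_succ, agr_flip, flipAt_same]
    by_cases h : Agr r y x
    · rcases eq_or_eq_negPm (x r) (y r) with h' | h'
      · simp [h, h', (negPm_ne (x r)).symm]
      · simp [h, h', negPm_ne (x r)]
    · simp [h]
  rw [Finset.sum_congr rfl fun y _ => this y]
  ring

lemma Av_const {N : ℕ} (c : ℝ) (d : ℕ) : ∀ r : ℕ, r + d = N →
    ∀ x : Fin N → pmOne, Av (fun _ => c) r x = c := by
  induction d with
  | zero => intro r hr x; obtain rfl : r = N := by omega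
            exact Av_top _ _
  | succ d ih =>
    intro r hr x
    have h := Av_split (fun _ => c) (⟨r, by omega⟩ : Fin N) x
    simp only at h
    rw [ih (r+1) (by omega), ih (r+1) (by omega)] at h
    linarith

lemma Av_flip_diff {N : ℕ} (f : (Fin N → pmOne) → ℝ) (r : Fin N) (x : Fin N → pmOne) (C : ℝ)
    (hf : ∀ y, |f y - f (flipAt r y)| ≤ C) :
    |Av f ((r : ℕ) + 1) x - Av f ((r : ℕ) + 1) (flipAt r x)| ≤ C := by
  have h1 : Av f ((r : ℕ) + 1) (flipAt r x) = Av (fun y => f (flipAt r y)) ((r:ℕ)+1) x := by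
    simp only [Av]
    congr 1
    rw [← sum_flipAt r]
    refine Finset.sum_congr rfl fun y _ => ?_
    have : Agr ((r:ℕ)+1) (flipAt r y) (flipAt r x) ↔ Agr ((r:ℕ)+1) y x := by
      rw [agr_succ, agr_succ, agr_flip, agr_flip_left, flipAt_same, flipAt_same]
      rw [(show Function.Injective negPm from
        Function.Involutive.injective negPm_negPm).eq_iff]
    simp only [this]
  rw [h1, ← Av_const (N := N) C (N - (r+1)) (r+1) (by omega) x]
  simp only [Av]
  rw [← mul_sub, ← Finset.sum_sub_distrib, abs_mul, abs_of_nonneg (by positivity)]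
  refine mul_le_mul_of_nonneg_left ?_ (by positivity)
  refine (Finset.abs_sum_le_sum_abs _ _).trans (Finset.sum_le_sum fun y _ => ?_)
  split_ifs
  · exact hf y
  · simp

lemma Av_sum {N : ℕ} (T : Finset ℕ) (lam : ℕ → ℝ) (f : ℕ → (Fin N → pmOne) → ℝ) (r : ℕ)
    (x : Fin N → pmOne) :
    Av (fun y => ∑ i ∈ T, lam i * f i y) r x = ∑ i ∈ T, lam i * Av (f i) r x := by
  simp only [Av, Finset.mul_sum]
  rw [Finset.sum_comm]
  refine Finset.sum_congr rfl fun y _ => ?_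
  by_cases h : Agr r y x
  · simp only [h, if_true, Finset.mul_sum]
    exact Finset.sum_congr rfl fun i _ => by ring
  · simp [h]

/-- one step of the martingale difference method -/
lemma exp_step {N : ℕ} (f : (Fin N → pmOne) → ℝ) (r : Fin N) (c : ℝ)
    (hc : ∀ x, |Av f ((r : ℕ) + 1) x - Av f ((r : ℕ) + 1) (flipAt r x)| ≤ 2 * c) :
    ∑ x, Real.exp (Av f ((r:ℕ)+1) x) ≤ Real.exp (c ^ 2 / 2) * ∑ x, Real.exp (Av f r x) := by
  have h2 : 2 * ∑ x, Real.exp (Av f ((r:ℕ)+1) x) =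
      ∑ x, (Real.exp (Av f ((r:ℕ)+1) x) + Real.exp (Av f ((r:ℕ)+1) (flipAt r x))) := by
    rw [Finset.sum_add_distrib, sum_flipAt r (fun x => Real.exp (Av f ((r:ℕ)+1) x))]
    ring
  have h3 : ∑ x, (Real.exp (Av f ((r:ℕ)+1) x) + Real.exp (Av f ((r:ℕ)+1) (flipAt r x))) ≤
      ∑ x, 2 * (Real.exp (c ^ 2 / 2) * Real.exp (Av f r x)) := by
    refine Finset.sum_le_sum fun x _ => ?_
    have hs := Av_split f r x
    have hd := hc x
    set a := Av f ((r:ℕ)+1) x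
    set b := Av f ((r:ℕ)+1) (flipAt r x)
    have ha : a = Av f r x + (a - b) / 2 := by linarith
    have hb : b = Av f r x + -((a - b) / 2) := by linarith
    have h := Real.cosh_le_exp_half_sq ((a - b) / 2)
    rw [Real.cosh_eq] at h
    have h5 : ((a - b) / 2) ^ 2 ≤ c ^ 2 := by
      apply sq_le_sq'
      · linarith [neg_abs_le (a - b)]
      · linarith [le_abs_self (a - b)]
    have h6 : Real.exp (((a - b) / 2) ^ 2 / 2) ≤ Real.exp (c ^ 2 / 2) :=
      Real.exp_le_exp.2 (by linarith)
    have h7 : Real.exp a + Real.exp b =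
        Real.exp (Av f r x) * (Real.exp ((a - b) / 2) + Real.exp (-((a - b) / 2))) := by
      rw [mul_add, ← Real.exp_add, ← Real.exp_add, ← ha, ← hb]
    rw [h7]
    nlinarith [Real.exp_pos (Av f r x)]
  rw [← Finset.mul_sum, ← Finset.mul_sum] at h3
  linarith

lemma exp_chain {N : ℕ} (f : (Fin N → pmOne) → ℝ) (c : ℕ → ℝ)
    (hc : ∀ (r : Fin N) x,
      |Av f ((r : ℕ) + 1) x - Av f ((r : ℕ) + 1) (flipAt r x)| ≤ 2 * c r)
    (h0 : ∀ x, Av f 0 x = 0) (r : ℕ) (hr : r ≤ N) :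
    ∑ x, Real.exp (Av f r x) ≤ 2 ^ N * Real.exp (∑ k ∈ Finset.range r, c k ^ 2 / 2) := by
  induction r with
  | zero =>
    have hcard : Fintype.card pmOne = 2 := by
      rw [Fintype.card_coe]; unfold pmOne
      rw [Finset.card_pair]; norm_num
    simp [h0, hcard]
  | succ r ih =>
    refine (exp_step f ⟨r, by omega⟩ (c r) (hc ⟨r, by omega⟩)).trans ?_
    rw [Finset.sum_range_succ, Real.exp_add]
    have := mul_le_mul_of_nonneg_left (ih (by omega)) (Real.exp_pos (c r ^ 2 / 2)).le
    refine this.trans (le_of_eq (by ring))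

/-- deterministic block summation -/
lemma block_sum (w : ℕ → ℕ) (g h : ℕ → ℝ) (K : ℕ)
    (H : ∀ l ≤ K, ∀ m, ∑ i ∈ Finset.range l, w i ≤ m → g m ≤ h l) :
    ∑ m ∈ Finset.range (∑ i ∈ Finset.range (K + 1), w i), g m ≤
      ∑ l ∈ Finset.range (K + 1), (w l : ℝ) * h l := by
  have : ∀ L ≤ K + 1, ∑ m ∈ Finset.range (∑ i ∈ Finset.range L, w i), g m ≤
      ∑ l ∈ Finset.range L, (w l : ℝ) * h l := by
    intro L
    induction L with
    | zero => simp
    | succ L ih =>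
      intro hL
      rw [Finset.sum_range_succ, Finset.sum_range_succ _ L, Finset.sum_range_add]
      refine add_le_add (ih (by omega)) ?_
      refine (Finset.sum_le_sum (g := fun _ => h L) fun m _ => H L (by omega) _ (by omega)).trans ?_
      simp
  exact this _ le_rfl

lemma real_ineq (α ζ θ : ℝ) (hα₁ : 1 / 2 < α) (hα₂ : α < 1) (hζ : 0 < ζ) (hθ : 0 < θ)
    (a b : ℝ) (ha : 0 < a) (hab : a ≤ b) :
    2 * θ ^ 2 * (a * (ζ / (16 * θ ^ 2) * b ^ (α - 1)) ^ 2 ) ≤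
      ζ / 4 * (a ^ α * (ζ / (16 * θ ^ 2) * b ^ (α - 1))) := by
  have hb : 0 < b := by linarith
  have h1 : a * b ^ (α - 1) ≤ a ^ α := by
    have : b ^ (α - 1) ≤ a ^ (α - 1) := Real.rpow_le_rpow_of_nonpos ha hab (by linarith)
    have h2 : a ^ α = a * a ^ (α - 1) := by
      rw [← Real.rpow_one_add' ha.le (by linarith)]; congr 1; ring
    rw [h2]
    exact mul_le_mul_of_nonneg_left this ha.le
  have hB : 0 < b ^ (α - 1) := Real.rpow_pos_of_pos hb _
  set B := b ^ (α - 1)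
  have hA : 0 < a ^ α := Real.rpow_pos_of_pos ha _
  have e1 : 2 * θ ^ 2 * (a * (ζ / (16 * θ ^ 2) * B) ^ 2) = ζ ^ 2 / (128 * θ ^ 2) * B * (a * B) := by
    field_simp; norm_num
  have e2 : ζ / 4 * (a ^ α * (ζ / (16 * θ ^ 2) * B)) = ζ ^ 2 / (128 * θ ^ 2) * B * (2 * a ^ α) := by
    field_simp; norm_num
  rw [e1, e2]
  refine mul_le_mul_of_nonneg_left ?_ (by positivity)
  linarith

lemma real_ineq2 (α ζ θ : ℝ) (hζ : 0 < ζ) (hθ : 0 < θ)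
    (a : ℝ) (ha : 0 < a) :
    2 * θ ^ 2 * (a * (ζ / (16 * θ ^ 2) * a ^ (α - 1)) ^ 2 ) -
      ζ / 4 * (a ^ α * (ζ / (16 * θ ^ 2) * a ^ (α - 1))) ≤
      -(ζ ^ 2 / (2 ^ 10 * θ ^ 2)) * a ^ (2 * α - 1) := by
  have h1 : a * a ^ (α - 1) * a ^ (α - 1) = a ^ (2 * α - 1) := by
    nth_rewrite 1 [← Real.rpow_one a]
    rw [← Real.rpow_add ha, ← Real.rpow_add ha]; congr 1; ring
  have h2 : a ^ α * a ^ (α - 1) = a ^ (2 * α - 1) := by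
    rw [← Real.rpow_add ha]; congr 1; ring
  have hX : 0 < a ^ (2 * α - 1) := Real.rpow_pos_of_pos ha _
  have e1 : 2 * θ ^ 2 * (a * (ζ / (16 * θ ^ 2) * a ^ (α - 1)) ^ 2 ) =
      2 * θ ^ 2 * (ζ / (16 * θ ^ 2)) ^ 2 * (a * a ^ (α - 1) * a ^ (α - 1)) := by ring
  have e2 : ζ / 4 * (a ^ α * (ζ / (16 * θ ^ 2) * a ^ (α - 1))) =
      ζ / 4 * (ζ / (16 * θ ^ 2)) * (a ^ α * a ^ (α - 1)) := by ring
  rw [e1, e2, h1, h2, ← sub_mul]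
  refine mul_le_mul_of_nonneg_right ?_ hX.le
  have : 2 * θ ^ 2 * (ζ / (16 * θ ^ 2)) ^ 2 - ζ / 4 * (ζ / (16 * θ ^ 2)) =
     - (8 * (ζ ^ 2 / (2 ^ 10 * θ ^ 2))) := by field_simp; norm_num
  rw [this]
  have : 0 < ζ ^ 2 / (2 ^ 10 * θ ^ 2) := by positivity
  linarith

/-- **Key probabilistic lemma (Lemma 4.1 in abstract form).**
Let `h₁,…,h_N` be i.i.d. uniform on `{-1,+1}` (here: the uniform measure on
`(pmOne)^N`, every configuration having weight `2^{-N}`).  We write `s = j+1 ∈ {0,…,K}`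
for the shifted index (`j ∈ {-1,0,…,K-1}` in the paper).  Given strictly increasing
positive masses `Δ₀ < … < Δ_K`, multiplicities `n₀,…,n_K ≥ 1` with
`M_i = Σ_{ℓ≤i} n_ℓ Δ_ℓ` and `M_K ≤ N`, and functions `F_s,…,F_K : {-1,+1}^N → ℝ` such that
(i) each `F_i` varies by at most `4θ` under a change of exactly one coordinate, and
(ii) for all `r ≤ N - M_i`, the conditional expectation of `F_i` given the first `r`
coordinates vanishes (i.e. the sum of `F_i` over all configurations agreeing with any given
one on the first `r` coordinates is `0`), then
`P[∀ i ∈ {s,…,K} : F_i > (ζ/4) Σ_{ℓ=0}^i n_ℓ Δ_ℓ^α]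
  ≤ exp(-(ζ²/(2¹⁰θ²)) Σ_{ℓ=s}^K n_ℓ Δ_ℓ^{2α-1})`. -/
theorem key_probabilistic_lemma
    (α ζ θ : ℝ) (hα₁ : 1 / 2 < α) (hα₂ : α < 1) (hζ : 0 < ζ) (hθ : 0 < θ)
    (N : ℕ) (hN : 1 ≤ N) (K : ℕ)
    (Δ n : ℕ → ℕ)
    (hΔpos : ∀ ℓ, ℓ ≤ K → 0 < Δ ℓ)
    (hΔmono : ∀ ℓ, ℓ < K → Δ ℓ < Δ (ℓ + 1))
    (hnpos : ∀ ℓ, ℓ ≤ K → 0 < n ℓ)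
    (M : ℕ → ℕ) (hM : ∀ i, M i = ∑ ℓ ∈ Finset.range (i + 1), n ℓ * Δ ℓ)
    (hMK : M K ≤ N)
    (s : ℕ) (hs : s ≤ K)
    (F : ℕ → (Fin N → ℝ) → ℝ)
    (hLip : ∀ i ∈ Finset.Icc s K, ∀ x y : Fin N → ℝ,
      (∀ k, x k ∈ pmOne) → (∀ k, y k ∈ pmOne) →
      (∃ k, x k ≠ y k ∧ (∀ k', k' ≠ k → x k' = y k')) →
      |F i x - F i y| ≤ 4 * θ)
    (hcond : ∀ i ∈ Finset.Icc s K, ∀ r : ℕ, r ≤ N - M i →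
      ∀ x : Fin N → pmOne,
        ∑ y : Fin N → pmOne,
          (if ∀ k : Fin N, (k : ℕ) < r → y k = x k
           then F i (fun k => (y k : ℝ)) else 0) = 0) :
    (1 / 2 ^ N) *
        ∑ x : Fin N → pmOne,
          (if ∀ i ∈ Finset.Icc s K,
              (ζ / 4) * ∑ ℓ ∈ Finset.range (i + 1), (n ℓ : ℝ) * (Δ ℓ : ℝ) ^ α
                < F i (fun k => (x k : ℝ))
           then (1 : ℝ) else 0)
      ≤ Real.exp (-(ζ ^ 2 / (2 ^ 10 * θ ^ 2)) *
          ∑ ℓ ∈ Finset.Icc s K, (n ℓ : ℝ) * (Δ ℓ : ℝ) ^ (2 * α - 1)) := by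
  set c : ℝ := ζ / (16 * θ ^ 2) with hcdef
  have hcpos : 0 < c := by positivity
  set u : ℕ → ℝ := fun i => if i ≤ K then c * (Δ i : ℝ) ^ (α - 1) else 0 with hu
  set lam : ℕ → ℝ := fun i => u i - u (i + 1) with hlam
  have hΔle : ∀ a b, a ≤ b → b ≤ K → Δ a ≤ Δ b := by
    intro a b hab
    induction b, hab using Nat.le_induction with
    | base => intro _; exact le_rfl
    | succ b hb ih => intro h; exact (ih (by omega)).trans (hΔmono b (by omega)).le
  have hunn : ∀ i, 0 ≤ u i := by
    intro i; simp only [hu]; split_ifs <;> positivity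
  have hlnn : ∀ i ≤ K, 0 ≤ lam i := by
    intro i hi
    simp only [hlam, hu, hi, if_true]
    split_ifs with h
    · rw [← mul_sub]
      refine mul_nonneg hcpos.le (sub_nonneg.2 ?_)
      exact Real.rpow_le_rpow_of_nonpos (by exact_mod_cast hΔpos i hi)
        (by exact_mod_cast hΔle i (i+1) (by omega) h) (by linarith)
    · rw [sub_zero]; positivity
  have htel : ∀ l ≤ K, ∑ i ∈ (Finset.Icc s K).filter (fun i => l ≤ i), lam i = u (max l s) := by
    intro l hl
    have e : (Finset.Icc s K).filter (fun i => l ≤ i) = Finset.Ico (max l s) (K + 1) := by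
      ext i; simp only [Finset.mem_filter, Finset.mem_Icc, Finset.mem_Ico]; omega
    have h0 : u (K + 1) = 0 := by simp [hu]
    have := Finset.sum_Ico_sub u (show max l s ≤ K + 1 by omega)
    rw [e, ← neg_inj, ← Finset.sum_neg_distrib]
    simp only [hlam, neg_sub]
    rw [this, h0]; ring
  have hMmono : Monotone M := by
    intro a b hab
    rw [hM, hM]
    exact Finset.sum_le_sum_of_subset (Finset.range_mono (by omega))
  set f : ℕ → (Fin N → pmOne) → ℝ := fun i x => F i (fun k => (x k : ℝ)) with hf
  set G : (Fin N → pmOne) → ℝ := fun y => ∑ i ∈ Finset.Icc s K, lam i * f i y with hG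
  have hAv0 : ∀ i ∈ Finset.Icc s K, ∀ r ≤ N - M i, ∀ x, Av (f i) r x = 0 := by
    intro i hi r hr x
    have := hcond i hi r hr x
    simp only [Av]
    refine mul_eq_zero_of_right _ ?_
    rw [← this]
    refine Finset.sum_congr rfl fun y _ => ?_
    unfold Agr
    congr
  have hdiff : ∀ i ∈ Finset.Icc s K, ∀ (r : Fin N) (x : Fin N → pmOne),
      |Av (f i) ((r : ℕ) + 1) x - Av (f i) ((r : ℕ) + 1) (flipAt r x)| ≤ 4 * θ := by
    intro i hi r x
    refine Av_flip_diff (f i) r x _ fun y => ?_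
    refine hLip i hi _ _ (fun k => (y k).2) (fun k => (flipAt r y k).2) ⟨r, ?_, ?_⟩
    · intro h
      rw [flipAt_same] at h
      exact negPm_ne (y r) (Subtype.ext h.symm)
    · intro k hk
      rw [flipAt_ne _ _ _ hk]
  set L : ℕ → ℝ := fun m => ∑ i ∈ (Finset.Icc s K).filter (fun i => m < M i), lam i with hL
  have hLnn : ∀ m, 0 ≤ L m := fun m => Finset.sum_nonneg fun i hi => hlnn i (by
    simp only [Finset.mem_filter, Finset.mem_Icc] at hi; omega)
  have hchain := exp_chain G (fun r => 2 * θ * L (N - 1 - r)) (by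
    intro r x
    simp only [hG, Av_sum]
    rw [← Finset.sum_sub_distrib]
    refine (Finset.abs_sum_le_sum_abs _ _).trans ?_
    simp only [hL]
    rw [Finset.sum_filter, Finset.mul_sum, Finset.mul_sum]
    refine Finset.sum_le_sum fun i hi => ?_
    have hiK : i ≤ K := (Finset.mem_Icc.1 hi).2
    have hMi := hMmono hiK
    have hr := r.2
    rw [← mul_sub, abs_mul, abs_of_nonneg (hlnn i hiK)]
    split_ifs with h
    · nlinarith [hdiff i hi r x, hlnn i hiK]
    · rw [hAv0 i hi _ (by omega), hAv0 i hi _ (by omega)]; simp)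
    (by
      intro x
      simp only [hG, Av_sum]
      refine Finset.sum_eq_zero fun i hi => ?_
      rw [hAv0 i hi 0 (by omega), mul_zero]) N le_rfl
  simp only [Av_top] at hchain
  rw [Finset.sum_range_reflect (fun r => (2 * θ * L r) ^ 2 / 2)] at hchain
  set E : ℝ := ∑ m ∈ Finset.range N, (2 * θ * L m) ^ 2 / 2 with hE
  have hEle : E ≤ ∑ l ∈ Finset.range (K + 1), ((n l * Δ l : ℕ) : ℝ) * (2 * θ ^ 2 * u (max l s) ^ 2) := by
    have h1 : E = ∑ m ∈ Finset.range (M K), (2 * θ * L m) ^ 2 / 2 := by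
      symm
      refine Finset.sum_subset (Finset.range_mono hMK) fun m _ hm => ?_
      have : L m = 0 := by
        simp only [hL]
        rw [Finset.filter_false_of_mem, Finset.sum_empty]
        intro i hi
        have := hMmono (Finset.mem_Icc.1 hi).2
        simp only [Finset.mem_range] at hm
        omega
      rw [this]; simp
    rw [h1, hM K]
    refine block_sum (fun l => n l * Δ l) _ _ K ?_
    intro l hl m hm
    have hLu : L m ≤ u (max l s) := by
      rw [← htel l hl]
      refine Finset.sum_le_sum_of_subset_of_nonneg ?_ ?_
      · intro i hi
        simp only [Finset.mem_filter] at hi ⊢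
        refine ⟨hi.1, ?_⟩
        by_contra hlt
        have h2 : M i ≤ ∑ i ∈ Finset.range l, n i * Δ i := by
          rw [hM]
          exact Finset.sum_le_sum_of_subset (Finset.range_mono (by omega))
        have := hi.2
        omega
      · intro i hi _
        simp only [Finset.mem_filter, Finset.mem_Icc] at hi
        exact hlnn i hi.1.2
    have h3 : L m ^ 2 ≤ u (max l s) ^ 2 := pow_le_pow_left₀ (hLnn m) hLu 2
    have h4 : (2 * θ * L m) ^ 2 / 2 = 2 * θ ^ 2 * L m ^ 2 := by ring
    rw [h4]
    exact mul_le_mul_of_nonneg_left h3 (by positivity)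
  set T : ℝ := ∑ i ∈ Finset.Icc s K, lam i *
    ((ζ / 4) * ∑ ℓ ∈ Finset.range (i + 1), (n ℓ : ℝ) * (Δ ℓ : ℝ) ^ α) with hT
  have hTeq : T = ∑ l ∈ Finset.range (K + 1), ζ / 4 * ((n l : ℝ) * (Δ l : ℝ) ^ α * u (max l s)) := by
    have h1 : ∀ i ∈ Finset.Icc s K, lam i *
        ((ζ / 4) * ∑ ℓ ∈ Finset.range (i + 1), (n ℓ : ℝ) * (Δ ℓ : ℝ) ^ α) =
        ∑ l ∈ Finset.range (K + 1), if l ≤ i then ζ / 4 * ((n l : ℝ) * (Δ l : ℝ) ^ α) * lam i else 0 := by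
      intro i hi
      have hiK : i ≤ K := (Finset.mem_Icc.1 hi).2
      rw [← Finset.sum_filter]
      have e : (Finset.range (K + 1)).filter (fun l => l ≤ i) = Finset.range (i + 1) := by
        ext l; simp only [Finset.mem_filter, Finset.mem_range]; omega
      rw [e, Finset.mul_sum, Finset.mul_sum]
      exact Finset.sum_congr rfl fun l _ => by ring
    rw [hT, Finset.sum_congr rfl h1, Finset.sum_comm]
    refine Finset.sum_congr rfl fun l hl => ?_
    rw [← Finset.sum_filter, ← Finset.mul_sum, htel l (by simp at hl; omega)]
    ring
  have hfinal : E - T ≤ -(ζ ^ 2 / (2 ^ 10 * θ ^ 2)) *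
          ∑ ℓ ∈ Finset.Icc s K, (n ℓ : ℝ) * (Δ ℓ : ℝ) ^ (2 * α - 1) := by
    have e : Finset.Icc s K = (Finset.range (K + 1)).filter (fun l => s ≤ l) := by
      ext l; simp only [Finset.mem_filter, Finset.mem_range, Finset.mem_Icc]; omega
    rw [e, Finset.sum_filter, Finset.mul_sum, hTeq]
    refine (sub_le_sub_right hEle _).trans ?_
    rw [← Finset.sum_sub_distrib]
    refine Finset.sum_le_sum fun l hl => ?_
    have hlK : l ≤ K := by simp at hl; omega
    have hpos : (0 : ℝ) < Δ l := by exact_mod_cast hΔpos l hlK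
    have hn0 : (0 : ℝ) ≤ n l := by positivity
    have hmK : max l s ≤ K := by omega
    have humax : u (max l s) = c * (Δ (max l s) : ℝ) ^ (α - 1) := by simp only [hu, hmK, if_true]
    rw [humax]
    push_cast
    split_ifs with hsl
    · rw [max_eq_left hsl]
      have := mul_le_mul_of_nonneg_left (real_ineq2 α ζ θ hζ hθ (Δ l) hpos) hn0
      rw [← hcdef] at this
      linarith
    · have hle : (Δ l : ℝ) ≤ Δ (max l s) := by
        exact_mod_cast hΔle l (max l s) (by omega) hmK
      have := mul_le_mul_of_nonneg_left (real_ineq α ζ θ hα₁ hα₂ hζ hθ (Δ l) _ hpos hle) hn0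
      rw [← hcdef] at this
      linarith
  have hmarkov : ∀ x : Fin N → pmOne, (if ∀ i ∈ Finset.Icc s K,
              (ζ / 4) * ∑ ℓ ∈ Finset.range (i + 1), (n ℓ : ℝ) * (Δ ℓ : ℝ) ^ α
                < F i (fun k => (x k : ℝ))
           then (1 : ℝ) else 0) ≤ Real.exp (-T) * Real.exp (G x) := by
    intro x
    split_ifs with h
    · rw [← Real.exp_add]
      refine Real.one_le_exp ?_
      have : T ≤ G x := Finset.sum_le_sum fun i hi =>
        mul_le_mul_of_nonneg_left (h i hi).le (hlnn i (Finset.mem_Icc.1 hi).2)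
      linarith
    · positivity
  refine le_trans ?_ (Real.exp_le_exp.2 hfinal)
  refine (mul_le_mul_of_nonneg_left (Finset.sum_le_sum fun x _ => hmarkov x)
    (by positivity)).trans ?_
  rw [← Finset.mul_sum]
  refine (mul_le_mul_of_nonneg_left (mul_le_mul_of_nonneg_left hchain (Real.exp_pos _).le)
    (by positivity)).trans (le_of_eq ?_)
  rw [sub_eq_add_neg, Real.exp_add]
  field_simp
end
end

section
/- Let θ > 0, let N ≥ 1 and let h₁, …, h_N be i.i.d. random variables uniform on {−1, +1}. Let positive integers M_{j+1} ≤ M_{j+2} ≤ … ≤ M_K ≤ N be given, and let F_{j+1}, …, F_K : {−1,+1}^N → ℝ be functions such that: (i) for every i and every pair of configurations x, y differing in exactly one coordinate, |F_i(x) − F_i(y)| ≤ 4θ; and (ii) for every i ∈ {j+1,…,K} and every 0 ≤ r ≤ N − M_i, E[F_i(h₁,…,h_N) | σ(h₁,…,h_r)] = 0 almost surely. Then for all nonnegative reals λ_{j+1}, …, λ_K, E[ exp( Σ_{i=j+1}^{K} λ_i F_i(h₁,…,h_N) ) ] ≤ exp( 16 θ² [ M_{j+1} (Σ_{ℓ=j+1}^{K}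 λ_ℓ)² + Σ_{i=j+2}^{K} (M_i − M_{i−1}) (Σ_{ℓ=i}^{K} λ_ℓ)² ] ). -/
open scoped BigOperators Classical

noncomputable section

/-- The point `+1`. -/
def pmP : pmOne := ⟨1, by simp [pmOne]⟩

/-- The point `-1`. -/
def pmQ : pmOne := ⟨-1, by simp [pmOne]⟩

theorem pm_sum (g : pmOne → ℝ) : ∑ b : pmOne, g b = g pmP + g pmQ := by
  have hu : (Finset.univ : Finset pmOne) = {pmP, pmQ} := by
    ext ⟨z, hz⟩
    have hz' : z = -1 ∨ z = 1 := by simpa [pmOne] using hz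
    simp only [Finset.mem_univ, Finset.mem_insert, Finset.mem_singleton, true_iff, pmP, pmQ]
    exact hz'.symm.imp (fun h => Subtype.ext h) (fun h => Subtype.ext h)
  have hne : pmP ≠ pmQ := by
    intro h
    have := congrArg Subtype.val h
    norm_num [pmP, pmQ] at this
  rw [hu, Finset.sum_pair hne]

/-- Replace the coordinate with number `k` by `b`. -/
def upd {N : ℕ} (x : Fin N → pmOne) (k : ℕ) (b : pmOne) : Fin N → pmOne :=
  fun j => if (j : ℕ) = k then b else x j

/-- Averaging over the coordinate with number `k`. -/
def avg {N : ℕ} (k : ℕ) (G : (Fin N → pmOne) → ℝ) : (Fin N → pmOne) → ℝ :=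
  fun x => (G (upd x k pmP) + G (upd x k pmQ)) / 2

/-- Averaging over the last `m` coordinates. -/
def cexp {N : ℕ} (G : (Fin N → pmOne) → ℝ) : ℕ → (Fin N → pmOne) → ℝ
  | 0 => G
  | m + 1 => avg (N - 1 - m) (cexp G m)

/-- One-coordinate oscillation bound. -/
def Osc {N : ℕ} (c : ℝ) (G : (Fin N → pmOne) → ℝ) : Prop :=
  ∀ x y : Fin N → pmOne, (∃ k : ℕ, ∀ j : Fin N, (j : ℕ) ≠ k → x j = y j) → |G x - G y| ≤ c

theorem avg_osc {N : ℕ} {c : ℝ} {G : (Fin N → pmOne) → ℝ} (h : Osc c G) (k : ℕ) :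
    Osc c (avg k G) := by
  rintro x y ⟨l, hl⟩
  have key : ∀ b, |G (upd x k b) - G (upd y k b)| ≤ c := by
    intro b
    apply h
    refine ⟨l, fun j hj => ?_⟩
    simp [upd, hl j hj]
  have h1 := abs_le.1 (key pmP)
  have h2 := abs_le.1 (key pmQ)
  simp only [avg]
  rw [abs_le]
  constructor <;> linarith [h1.1, h1.2, h2.1, h2.2]

theorem cexp_osc {N : ℕ} {c : ℝ} {G : (Fin N → pmOne) → ℝ} (h : Osc c G) (m : ℕ) :
    Osc c (cexp G m) := by
  induction m with
  | zero => exact h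
  | succ m ih => exact avg_osc ih _

theorem cexp_sum {N : ℕ} (I : Finset ℕ) (lam : ℕ → ℝ) (f : ℕ → (Fin N → pmOne) → ℝ) (m : ℕ) :
    ∀ x, cexp (fun x => ∑ i ∈ I, lam i * f i x) m x = ∑ i ∈ I, lam i * cexp (f i) m x := by
  induction m with
  | zero => intro x; rfl
  | succ m ih =>
    intro x
    simp only [cexp, avg, ih]
    rw [← Finset.sum_add_distrib, Finset.sum_div]
    apply Finset.sum_congr rfl
    intro i _
    ring

theorem cexp_eq {N : ℕ} (G : (Fin N → pmOne) → ℝ) (m : ℕ) : m ≤ N → ∀ x,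
    ∑ y : Fin N → pmOne, (if ∀ k : Fin N, (k : ℕ) < N - m → y k = x k then G y else 0)
      = 2 ^ m * cexp G m x := by
  induction m with
  | zero =>
    intro _ x
    simp only [pow_zero, one_mul, cexp]
    have : ∀ y : Fin N → pmOne, (∀ k : Fin N, (k : ℕ) < N - 0 → y k = x k) ↔ y = x := by
      intro y
      constructor
      · intro h
        funext k
        exact h k (by have := k.2; omega)
      · rintro rfl k _
        rfl
    simp only [this]
    simp
  | succ m ih =>
    intro hm x
    have e : (2 : ℝ) ^ (m + 1) * cexp G (m + 1) x
        = ∑ b : pmOne, 2 ^ m * cexp G m (upd x (N - 1 - m) b) := by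
      rw [pm_sum]
      simp only [cexp, avg]
      ring
    rw [e]
    simp only [← ih (by omega)]
    rw [Finset.sum_comm]
    apply Finset.sum_congr rfl
    intro y _
    let r : Fin N := ⟨N - 1 - m, by omega⟩
    have hiff : ∀ b : pmOne, (∀ k : Fin N, (k : ℕ) < N - m → y k = upd x (N - 1 - m) b k) ↔
        (b = y r ∧ ∀ k : Fin N, (k : ℕ) < N - (m + 1) → y k = x k) := by
      intro b
      constructor
      · intro h
        constructor
        · have := h r (by simp only [r]; omega)
          simpa [upd, r] using this.symm
        · intro k hk
          have := h k (by omega)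
          rwa [upd, if_neg (by omega)] at this
      · rintro ⟨rfl, h⟩ k hk
        unfold upd
        split_ifs with hkr
        · congr 1
          exact Fin.ext hkr
        · exact h k (by omega)
    simp only [hiff, ite_and]
    simp

theorem exp_avg (a b c : ℝ) (h : |a - b| ≤ 4 * c) :
    (Real.exp a + Real.exp b) / 2 ≤ Real.exp ((a + b) / 2 + 2 * c ^ 2) := by
  have h1 : (Real.exp a + Real.exp b) / 2
      = Real.exp ((a + b) / 2) * Real.cosh ((a - b) / 2) := by
    rw [Real.cosh_eq, mul_div_assoc', mul_add, ← Real.exp_add, ← Real.exp_add]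
    ring_nf
  rw [h1, Real.exp_add]
  apply mul_le_mul_of_nonneg_left _ (Real.exp_pos _).le
  refine (Real.cosh_le_exp_half_sq _).trans (Real.exp_le_exp.2 ?_)
  have := abs_le.1 h
  nlinarith [this.1, this.2]

theorem cexp_exp {N : ℕ} (S : (Fin N → pmOne) → ℝ) (c : ℕ → ℝ) (n : ℕ)
    (h : ∀ m, m < n → Osc (4 * c m) (cexp S m)) (m : ℕ) : m ≤ n → ∀ x,
    cexp (fun x => Real.exp (S x)) m x
      ≤ Real.exp (cexp S m x + ∑ j ∈ Finset.range m, 2 * c j ^ 2) := by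
  induction m with
  | zero => intro _ x; simp [cexp]
  | succ m ih =>
    intro hmn x
    have ih := ih (by omega)
    have h1 := ih (upd x (N - 1 - m) pmP)
    have h2 := ih (upd x (N - 1 - m) pmQ)
    have h3 := exp_avg _ _ _ (h m (by omega) (upd x (N - 1 - m) pmP) (upd x (N - 1 - m) pmQ)
      ⟨N - 1 - m, fun j hj => by simp [upd, hj]⟩)
    rw [Real.exp_add] at h1 h2
    have hE := Real.exp_pos (∑ j ∈ Finset.range m, 2 * c j ^ 2)
    have h4 := mul_le_mul_of_nonneg_right h3 hE.le
    rw [← Real.exp_add] at h4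
    simp only [cexp, avg]
    rw [Finset.sum_range_succ]
    calc _ ≤ _ := by
          refine le_trans ?_ h4
          linarith
      _ = _ := by
          congr 1
          ring

theorem sum_levels (K s : ℕ) (hs : s ≤ K) (M : ℕ → ℕ)
    (hMmono : ∀ i, s ≤ i → i < K → M i ≤ M (i + 1)) (lam : ℕ → ℝ) (t : ℕ) (hst : s ≤ t) :
    t ≤ K →
    ∑ m ∈ Finset.range (M t), (∑ i ∈ Finset.Icc s K, if m < M i then lam i else 0) ^ 2
      = (M s : ℝ) * (∑ ℓ ∈ Finset.Icc s K, lam ℓ) ^ 2 +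
            ∑ i ∈ Finset.Icc (s + 1) t,
              ((M i : ℝ) - (M (i - 1) : ℝ)) * (∑ ℓ ∈ Finset.Icc i K, lam ℓ) ^ 2 := by
  have mono : ∀ i j, s ≤ i → i ≤ j → j ≤ K → M i ≤ M j := by
    intro i j hi hij
    induction j, hij using Nat.le_induction with
    | base => intro _; exact le_rfl
    | succ j hj ih =>
      intro hjK
      exact (ih (by omega)).trans (hMmono j (by omega) (by omega))
  induction t, hst using Nat.le_induction with
  | base =>
    intro _
    rw [Finset.Icc_eq_empty (a := s + 1) (b := s) (by omega), Finset.sum_empty, add_zero]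
    rw [Finset.sum_congr rfl (g := fun _ => (∑ ℓ ∈ Finset.Icc s K, lam ℓ) ^ 2)]
    · simp
    · intro m hm
      congr 1
      apply Finset.sum_congr rfl
      intro i hi
      rw [Finset.mem_Icc] at hi
      rw [Finset.mem_range] at hm
      rw [if_pos (lt_of_lt_of_le hm (mono s i le_rfl hi.1 hi.2))]
  | succ t ht ih =>
    intro htK
    have hle := hMmono t ht (by omega)
    rw [Finset.sum_Icc_succ_top (by omega), ← add_assoc, ← ih (by omega),
      ← Finset.sum_range_add_sum_Ico _ hle]
    congr 1
    rw [Finset.sum_congr rfl (g := fun _ => (∑ ℓ ∈ Finset.Icc (t + 1) K, lam ℓ) ^ 2)]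
    · simp [Nat.cast_sub hle]
    · intro m hm
      rw [Finset.mem_Ico] at hm
      congr 1
      rw [← Finset.sum_filter]
      apply Finset.sum_congr _ (fun _ _ => rfl)
      ext i
      simp only [Finset.mem_filter, Finset.mem_Icc]
      constructor
      · rintro ⟨⟨h1, h2⟩, h3⟩
        refine ⟨?_, h2⟩
        by_contra hc
        have := mono i t h1 (by omega) (by omega)
        omega
      · rintro ⟨h1, h2⟩
        have := mono (t + 1) i (by omega) h1 h2
        exact ⟨⟨by omega, h2⟩, by omega⟩

/-- **Exponential moment estimate (4.15), via Yurinski's martingale method.**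
Let `h₁,…,h_N` be i.i.d. uniform on `{-1,+1}` (the uniform measure on `(pmOne)^N`).
We write `s = j+1` (so the paper's `j ∈ {-1,0,…}` corresponds to `s ∈ {0,1,…}`).
Given positive integers `M_s ≤ M_{s+1} ≤ … ≤ M_K ≤ N` and functions
`F_s,…,F_K : {-1,+1}^N → ℝ` such that (i) each `F_i` varies by at most `4θ` under a change
of exactly one coordinate and (ii) for all `r ≤ N - M_i` the conditional expectation of `F_i`
given the first `r` coordinates vanishes, then for all `λ_s,…,λ_K ≥ 0`,
`E[exp(Σ_{i=s}^K λ_i F_i)]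
  ≤ exp(16θ²[M_s (Σ_{ℓ=s}^K λ_ℓ)² + Σ_{i=s+1}^K (M_i - M_{i-1})(Σ_{ℓ=i}^K λ_ℓ)²])`. -/
theorem exponential_moment_estimate
    (θ : ℝ) (hθ : 0 < θ)
    (N : ℕ) (hN : 1 ≤ N) (K : ℕ) (s : ℕ) (hs : s ≤ K)
    (M : ℕ → ℕ)
    (hMpos : ∀ i ∈ Finset.Icc s K, 0 < M i)
    (hMmono : ∀ i, s ≤ i → i < K → M i ≤ M (i + 1))
    (hMK : M K ≤ N)
    (F : ℕ → (Fin N → ℝ) → ℝ)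
    (hLip : ∀ i ∈ Finset.Icc s K, ∀ x y : Fin N → ℝ,
      (∀ k, x k ∈ pmOne) → (∀ k, y k ∈ pmOne) →
      (∃ k, x k ≠ y k ∧ (∀ k', k' ≠ k → x k' = y k')) →
      |F i x - F i y| ≤ 4 * θ)
    (hcond : ∀ i ∈ Finset.Icc s K, ∀ r : ℕ, r ≤ N - M i →
      ∀ x : Fin N → pmOne,
        ∑ y : Fin N → pmOne,
          (if ∀ k : Fin N, (k : ℕ) < r → y k = x k
           then F i (fun k => (y k : ℝ)) else 0) = 0)
    (lam : ℕ → ℝ) (hlam : ∀ i ∈ Finset.Icc s K, 0 ≤ lam i) :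
    (1 / 2 ^ N) *
        ∑ x : Fin N → pmOne,
          Real.exp (∑ i ∈ Finset.Icc s K, lam i * F i (fun k => (x k : ℝ)))
      ≤ Real.exp (16 * θ ^ 2 *
          ((M s : ℝ) * (∑ ℓ ∈ Finset.Icc s K, lam ℓ) ^ 2 +
            ∑ i ∈ Finset.Icc (s + 1) K,
              ((M i : ℝ) - (M (i - 1) : ℝ)) * (∑ ℓ ∈ Finset.Icc i K, lam ℓ) ^ 2)) := by
  set f : ℕ → (Fin N → pmOne) → ℝ := fun i x => F i (fun k => (x k : ℝ)) with hf
  set S : (Fin N → pmOne) → ℝ := fun x => ∑ i ∈ Finset.Icc s K, lam i * f i x with hS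
  set L : ℕ → ℝ := fun m => ∑ i ∈ Finset.Icc s K, if m < M i then lam i else 0 with hL
  have mono : ∀ i, s ≤ i → i ≤ K → M i ≤ M K := by
    intro i hi hiK
    refine Nat.decreasingInduction' (P := fun j => M j ≤ M K) ?_ hiK le_rfl
    intro j hj hij hM
    exact (hMmono j (by omega) hj).trans hM
  have hosc : ∀ i ∈ Finset.Icc s K, Osc (4 * θ) (f i) := by
    rintro i hi x y ⟨k, hk⟩
    by_cases hxy : x = y
    · subst hxy
      simp [hθ.le]
    · obtain ⟨j, hj⟩ := Function.ne_iff.1 hxy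
      have hjk : (j : ℕ) = k := by
        by_contra hc
        exact hj (hk j hc)
      refine hLip i hi _ _ (fun k => (x k).2) (fun k => (y k).2) ⟨j, ?_, ?_⟩
      · exact fun h => hj (Subtype.ext h)
      · intro k' hk'
        rw [hk k' (fun h => hk' (Fin.ext (h.trans hjk.symm)))]
  have hzero : ∀ i ∈ Finset.Icc s K, ∀ m, M i ≤ m → m ≤ N → ∀ x, cexp (f i) m x = 0 := by
    intro i hi m hm hmN x
    have h1 := cexp_eq (f i) m hmN x
    rw [hcond i hi (N - m) (by omega) x] at h1
    have h2 : (2 : ℝ) ^ m ≠ 0 := by positivity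
    exact (mul_eq_zero.1 h1.symm).resolve_left h2
  have hoscS : ∀ m, m < N → Osc (4 * (θ * L m)) (cexp S m) := by
    intro m hm x y hxy
    rw [hS, cexp_sum, cexp_sum, ← Finset.sum_sub_distrib]
    refine (Finset.abs_sum_le_sum_abs _ _).trans ?_
    rw [hL, Finset.mul_sum, Finset.mul_sum]
    apply Finset.sum_le_sum
    intro i hi
    rw [← mul_sub, abs_mul, abs_of_nonneg (hlam i hi)]
    split_ifs with hmi
    · have := mul_le_mul_of_nonneg_left (cexp_osc (hosc i hi) m x y hxy) (hlam i hi)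
      linarith
    · rw [hzero i hi m (by omega) hm.le, hzero i hi m (by omega) hm.le]
      simp
  have x0 : Fin N → pmOne := fun _ => pmP
  have hmain := cexp_exp S (fun m => θ * L m) N hoscS N le_rfl x0
  have hS0 : cexp S N x0 = 0 := by
    rw [hS, cexp_sum]
    apply Finset.sum_eq_zero
    intro i hi
    have hi' := Finset.mem_Icc.1 hi
    rw [hzero i hi N ((mono i hi'.1 hi'.2).trans hMK) le_rfl, mul_zero]
  have hE := cexp_eq (fun x => Real.exp (S x)) N le_rfl x0
  simp only [Nat.sub_self, Nat.not_lt_zero, false_imp_iff, implies_true, if_true] at hE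
  have hlev : ∑ m ∈ Finset.range N, L m ^ 2 = ∑ m ∈ Finset.range (M K), L m ^ 2 := by
    symm
    apply Finset.sum_subset (Finset.range_mono hMK)
    intro m _ hm
    rw [Finset.mem_range, not_lt] at hm
    have : L m = 0 := by
      apply Finset.sum_eq_zero
      intro i hi
      have hi' := Finset.mem_Icc.1 hi
      have := mono i hi'.1 hi'.2
      rw [if_neg (by omega)]
    rw [this]
    norm_num
  rw [hE, ← sum_levels K s hs M hMmono lam K hs le_rfl, ← mul_assoc,
    one_div_mul_cancel (by positivity), one_mul]
  refine hmain.trans (Real.exp_le_exp.2 ?_)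
  rw [hS0, zero_add]
  change _ ≤ 16 * θ ^ 2 * ∑ m ∈ Finset.range (M K), L m ^ 2
  rw [← hlev, Finset.mul_sum]
  apply Finset.sum_le_sum
  intro m _
  nlinarith [sq_nonneg (θ * L m)]
end
end
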